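/- In the same setup (uniformly random arrangement of r_j copies of colour j, j = 1,…,k, total h ≥ 2, T = Σ_{i=2}^h 1[X_i = X_{i−1}]), the variance of T is Var(T) = m_2²/(h²(h−1)) + (h−3)m_2/(h(h−1)) − 2m_3/(h(h−1)), where m_2 = Σ_j r_j(r_j−1) and m_3 = Σ_j r_j(r_j−1)(r_j−2). (Assume h ≥ 2; for h = 2 interpret via the stated formula.) -/

import Mathlib

open Finset

/-- Averaging a function over the orbit of a point of a finite set on which a finite group acts
transitively: the sum over the group does not depend on the point. -/
theorem exists_sum_smul_eq {G X : Type*} [Group G] [Fintype G] [MulAction G X]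
    (s : Finset X) (hs : ∀ g : G, ∀ x ∈ s, g • x ∈ s)
    (ht : ∀ x ∈ s, ∀ y ∈ s, ∃ g : G, g • x = y) (F : X → ℝ) :
    ∃ S : ℝ, (∀ x ∈ s, ∑ g : G, F (g • x) = S) ∧
      (s.card : ℝ) * S = Fintype.card G * ∑ x ∈ s, F x := by
  obtain rfl | ⟨x₀, hx₀⟩ := s.eq_empty_or_nonempty
  · exact ⟨0, by simp⟩
  have key : ∀ x ∈ s, ∑ g : G, F (g • x) = ∑ g : G, F (g • x₀) := by
    intro x hx
    obtain ⟨t, rfl⟩ := ht x₀ hx₀ x hx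
    simp only [smul_smul]
    exact Fintype.sum_equiv (Equiv.mulRight t) _ _ fun g => by simp
  refine ⟨∑ g : G, F (g • x₀), key, ?_⟩
  rw [← nsmul_eq_mul, ← sum_const, ← sum_congr rfl key, sum_comm]
  have inner : ∀ g : G, ∑ x ∈ s, F (g • x) = ∑ x ∈ s, F x := by
    intro g
    refine sum_bij' (fun x _ => g • x) (fun x _ => g⁻¹ • x) (fun x hx => hs g x hx)
      (fun x hx => hs g⁻¹ x hx) ?_ ?_ ?_ <;> simp
  simp [inner]

section

variable {α κ : Type*} [Fintype α] [DecidableEq α] [DecidableEq κ]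

/-- The indicator that two distinct points have the same colour. -/
def agree (c : α → κ) (a b : α) : ℝ := if a ≠ b ∧ c a = c b then 1 else 0

omit [Fintype α] in
theorem agree_comm (c : α → κ) (a b : α) : agree c a b = agree c b a := by
  simp only [agree, ne_comm (a := a), eq_comm (a := c a)]

omit [Fintype α] in
theorem agree_self (c : α → κ) (a : α) : agree c a a = 0 := by simp [agree]

omit [Fintype α] in
theorem agree_mul_self (c : α → κ) (a b : α) : agree c a b * agree c a b = agree c a b := by
  simp [agree]

/-- Pairs of distinct points. -/
def distinctPairs (α : Type*) [Fintype α] [DecidableEq α] : Finset (α × α) :=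
  univ.filter fun x => x.1 ≠ x.2

/-- Triples of distinct points. -/
def distinctTriples (α : Type*) [Fintype α] [DecidableEq α] : Finset (α × α × α) :=
  univ.filter fun x => x.1 ≠ x.2.1 ∧ x.1 ≠ x.2.2 ∧ x.2.1 ≠ x.2.2

/-- Quadruples of distinct points. -/
def distinctQuadruples (α : Type*) [Fintype α] [DecidableEq α] : Finset (α × α × α × α) :=
  univ.filter fun x => x.1 ≠ x.2.1 ∧ x.1 ≠ x.2.2.1 ∧ x.1 ≠ x.2.2.2 ∧ x.2.1 ≠ x.2.2.1 ∧
    x.2.1 ≠ x.2.2.2 ∧ x.2.2.1 ≠ x.2.2.2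

/-- The number of points of colour `j`, as a real number. -/
def colourCount (c : α → κ) (j : κ) : ℝ := ((univ.filter fun i => c i = j).card : ℝ)

theorem sum_agree (c : α → κ) (a : α) : ∑ b, agree c a b = colourCount c (c a) - 1 := by
  have h : ∀ b, agree c a b = (if c b = c a then 1 else 0) - (if a = b then 1 else 0) := by
    intro b
    unfold agree
    by_cases hab : a = b
    · simp [hab]
    · simp [hab, eq_comm]
  simp [h, colourCount]

omit [DecidableEq α] in
theorem sum_comp_colour [Fintype κ] (c : α → κ) (f : κ → ℝ) :
    ∑ a, f (c a) = ∑ j, colourCount c j * f j := by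
  rw [← sum_fiberwise univ c]
  refine sum_congr rfl fun j _ => ?_
  rw [sum_congr rfl (g := fun _ => f j) (by simp +contextual)]
  simp [colourCount]

theorem sum_distinctPairs_agree (c : α → κ) :
    ∑ x ∈ distinctPairs α, agree c x.1 x.2 = ∑ a, (colourCount c (c a) - 1) := by
  rw [distinctPairs, sum_filter, Fintype.sum_prod_type]
  refine sum_congr rfl fun a _ => ?_
  rw [← sum_agree]
  refine sum_congr rfl fun b _ => ?_
  by_cases h : a = b <;> simp [h, agree_self]

theorem sum_distinctTriples_agree (c : α → κ) :
    ∑ x ∈ distinctTriples α, agree c x.1 x.2.1 * agree c x.1 x.2.2 =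
      ∑ a, (colourCount c (c a) - 1) * (colourCount c (c a) - 2) := by
  rw [distinctTriples, sum_filter, Fintype.sum_prod_type]
  refine sum_congr rfl fun a _ => ?_
  rw [Fintype.sum_prod_type]
  have h : ∀ b e, (if a ≠ b ∧ a ≠ e ∧ b ≠ e then agree c a b * agree c a e else 0) =
      agree c a b * agree c a e - if b = e then agree c a b else 0 := by
    intro b e
    by_cases h1 : a = b
    · simp [h1, agree_self]
    by_cases h2 : a = e
    · subst h2
      by_cases h3 : b = a <;> simp_all [agree_self]
    by_cases h3 : b = e
    · simp [h3, agree_mul_self]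
    · simp [h1, h2, h3]
  simp only [h, sum_sub_distrib, ← mul_sum, ← sum_mul, sum_ite_eq, mem_univ, if_true, sum_agree]
  ring

theorem sum_distinctQuadruples_agree (c : α → κ) :
    ∑ x ∈ distinctQuadruples α, agree c x.1 x.2.1 * agree c x.2.2.1 x.2.2.2 =
      (∑ a, (colourCount c (c a) - 1)) ^ 2
        - 4 * ∑ a, (colourCount c (c a) - 1) * (colourCount c (c a) - 2)
        - 2 * ∑ a, (colourCount c (c a) - 1) := by
  have h : ∀ a b d e, (if a ≠ b ∧ a ≠ d ∧ a ≠ e ∧ b ≠ d ∧ b ≠ e ∧ d ≠ e then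
        agree c a b * agree c d e else 0) =
      agree c a b * agree c d e
        - (if a = d then agree c a b * agree c a e else 0)
        - (if a = e then agree c a b * agree c a d else 0)
        - (if b = d then agree c b a * agree c b e else 0)
        - (if b = e then agree c b a * agree c b d else 0)
        + (if a = d then if b = e then agree c a b else 0 else 0)
        + (if a = e then if b = d then agree c a b else 0 else 0) := by
    intro a b d e
    by_cases hab : a = b
    · simp [hab, agree_self]
    by_cases hde : d = e
    · subst hde
      by_cases h1 : a = d
      · subst h1
        simp [agree_self, hab, Ne.symm hab]
      by_cases h2 : b = d
      · subst h2
        simp [agree_self, hab]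
      simp [agree_self, h1, h2]
    by_cases h1 : a = d
    · subst h1
      by_cases h2 : b = e
      · subst h2
        simp [hab, Ne.symm hab, agree_mul_self, agree_comm c b a]
      · simp [hab, Ne.symm hab, hde, h2]
    by_cases h2 : a = e
    · subst h2
      by_cases h3 : b = d
      · subst h3
        simp [hab, Ne.symm hab, agree_mul_self, agree_comm c b a]
      · simp [hab, Ne.symm hab, h1, h3, agree_comm c d a]
    by_cases h3 : b = d
    · subst h3
      simp [hab, h2, hde, agree_comm c b a]
    by_cases h4 : b = e
    · subst h4
      simp [hab, h1, h3, agree_comm c b a, agree_comm c d b]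
    simp [*]
  have hrow : ∀ a, ∑ b, ∑ e, agree c a b * agree c a e = (colourCount c (c a) - 1) ^ 2 := by
    intro a
    simp only [← mul_sum, ← sum_mul, sum_agree, sq]
  have hsq : ∑ a, (colourCount c (c a) - 1) ^ 2 =
      ∑ a, (colourCount c (c a) - 1) * (colourCount c (c a) - 2)
        + ∑ a, (colourCount c (c a) - 1) := by
    rw [← sum_add_distrib]
    exact sum_congr rfl fun a _ => by ring
  have s0 : ∑ a, ∑ b, ∑ d, ∑ e, agree c a b * agree c d e =
      (∑ a, (colourCount c (c a) - 1)) ^ 2 := by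
    simp only [← mul_sum, ← sum_mul, sum_agree, sq]
  have s1 : ∑ a, ∑ b, ∑ d, ∑ e, (if a = d then agree c a b * agree c a e else 0) =
      ∑ a, (colourCount c (c a) - 1) ^ 2 := by
    refine sum_congr rfl fun a _ => ?_
    rw [← hrow]
    refine sum_congr rfl fun b _ => ?_
    rw [sum_comm]
    simp
  have s2 : ∑ a, ∑ b, ∑ d, ∑ e, (if a = e then agree c a b * agree c a d else 0) =
      ∑ a, (colourCount c (c a) - 1) ^ 2 := by
    simp [← hrow]
  have s3 : ∑ a, ∑ b, ∑ d, ∑ e, (if b = d then agree c b a * agree c b e else 0) =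
      ∑ a, (colourCount c (c a) - 1) ^ 2 := by
    rw [sum_comm, s1]
  have s4 : ∑ a, ∑ b, ∑ d, ∑ e, (if b = e then agree c b a * agree c b d else 0) =
      ∑ a, (colourCount c (c a) - 1) ^ 2 := by
    rw [sum_comm, s2]
  have s5 : ∑ a, ∑ b, ∑ d, ∑ e, (if a = d then if b = e then agree c a b else 0 else 0) =
      ∑ a, (colourCount c (c a) - 1) := by
    simp only [← sum_agree]
    refine sum_congr rfl fun a _ => sum_congr rfl fun b _ => ?_
    rw [sum_comm]
    simp
  have s6 : ∑ a, ∑ b, ∑ d, ∑ e, (if a = e then if b = d then agree c a b else 0 else 0) =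
      ∑ a, (colourCount c (c a) - 1) := by
    simp [← sum_agree]
  generalize ∑ a, (colourCount c (c a) - 1) = M at *
  rw [distinctQuadruples, sum_filter]
  simp only [Fintype.sum_prod_type, h, sum_sub_distrib, sum_add_distrib]
  rw [s0, s1, s2, s3, s4, s5, s6, hsq]
  ring

theorem card_distinctPairs :
    ((distinctPairs α).card : ℝ) = Fintype.card α * (Fintype.card α - 1) := by
  have h := sum_distinctPairs_agree (fun _ : α => ())
  rw [sum_congr rfl (g := fun _ => 1)
    (by rintro ⟨a, b⟩ hx; simp_all [agree, distinctPairs])] at h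
  simpa [colourCount, mul_sub] using h

theorem card_distinctTriples :
    ((distinctTriples α).card : ℝ) =
      Fintype.card α * ((Fintype.card α - 1) * (Fintype.card α - 2)) := by
  have h := sum_distinctTriples_agree (fun _ : α => ())
  rw [sum_congr rfl (g := fun _ => 1)
    (by rintro ⟨a, b, d⟩ hx; simp_all [agree, distinctTriples])] at h
  simpa [colourCount] using h

theorem card_distinctQuadruples :
    ((distinctQuadruples α).card : ℝ) =
      Fintype.card α * (Fintype.card α - 1) * (Fintype.card α - 2) * (Fintype.card α - 3) := by
  have h := sum_distinctQuadruples_agree (fun _ : α => ())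
  rw [sum_congr rfl (g := fun _ => 1)
    (by rintro ⟨a, b, d, e⟩ hx; simp_all [agree, distinctQuadruples])] at h
  simp only [colourCount, sum_const, nsmul_eq_mul, mul_one, filter_true, card_univ] at h
  rw [h]
  ring

omit [Fintype α] [DecidableEq α] in
theorem exists_perm_comp_eq {m : ℕ} (f g : Fin m → α) (hf : Function.Injective f)
    (hg : Function.Injective g) : ∃ σ : Equiv.Perm α, ∀ i, σ (f i) = g i := by
  obtain ⟨σ, hσ⟩ := (Equiv.Perm.isMultiplyPretransitive α m).exists_smul_eq ⟨f, hf⟩ ⟨g, hg⟩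
  exact ⟨σ, fun i => by simpa using DFunLike.congr_fun hσ i⟩

theorem exists_sum_perm_pair (F : α → α → ℝ) :
    ∃ S : ℝ, (∀ a b, a ≠ b → ∑ σ : Equiv.Perm α, F (σ a) (σ b) = S) ∧
      ((distinctPairs α).card : ℝ) * S =
        (Fintype.card α).factorial * ∑ x ∈ distinctPairs α, F x.1 x.2 := by
  have inj : ∀ x ∈ distinctPairs α, Function.Injective ![x.1, x.2] := by
    rintro ⟨a, b⟩ hx i j
    simp only [distinctPairs, mem_filter, mem_univ, true_and] at hx
    fin_cases i <;> fin_cases j <;> simp [hx, hx.symm]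
  obtain ⟨S, h1, h2⟩ := exists_sum_smul_eq (G := Equiv.Perm α) (distinctPairs α)
    (by simp [distinctPairs]) (by
      intro x hx y hy
      obtain ⟨σ, hσ⟩ := exists_perm_comp_eq _ _ (inj x hx) (inj y hy)
      exact ⟨σ, Prod.ext (hσ 0) (hσ 1)⟩) (fun x => F x.1 x.2)
  refine ⟨S, fun a b hab => h1 (a, b) (by simpa [distinctPairs] using hab), ?_⟩
  rw [h2, Fintype.card_perm]

theorem exists_sum_perm_triple (F : α → α → α → ℝ) :
    ∃ S : ℝ, (∀ a b d, a ≠ b → a ≠ d → b ≠ d →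
        ∑ σ : Equiv.Perm α, F (σ a) (σ b) (σ d) = S) ∧
      ((distinctTriples α).card : ℝ) * S =
        (Fintype.card α).factorial * ∑ x ∈ distinctTriples α, F x.1 x.2.1 x.2.2 := by
  have inj : ∀ x ∈ distinctTriples α, Function.Injective ![x.1, x.2.1, x.2.2] := by
    rintro ⟨a, b, d⟩ hx i j
    simp only [distinctTriples, mem_filter, mem_univ, true_and] at hx
    fin_cases i <;> fin_cases j <;> simp [hx, hx.1.symm, hx.2.1.symm, hx.2.2.symm]
  obtain ⟨S, h1, h2⟩ := exists_sum_smul_eq (G := Equiv.Perm α) (distinctTriples α)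
    (by simp [distinctTriples]) (by
      intro x hx y hy
      obtain ⟨σ, hσ⟩ := exists_perm_comp_eq _ _ (inj x hx) (inj y hy)
      exact ⟨σ, Prod.ext (hσ 0) (Prod.ext (hσ 1) (hσ 2))⟩) (fun x => F x.1 x.2.1 x.2.2)
  refine ⟨S, fun a b d hab had hbd => h1 (a, b, d) (by simp [distinctTriples, *]), ?_⟩
  rw [h2, Fintype.card_perm]

theorem exists_sum_perm_quadruple (F : α → α → α → α → ℝ) :
    ∃ S : ℝ, (∀ a b d e, a ≠ b → a ≠ d → a ≠ e → b ≠ d → b ≠ e → d ≠ e →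
        ∑ σ : Equiv.Perm α, F (σ a) (σ b) (σ d) (σ e) = S) ∧
      ((distinctQuadruples α).card : ℝ) * S =
        (Fintype.card α).factorial *
          ∑ x ∈ distinctQuadruples α, F x.1 x.2.1 x.2.2.1 x.2.2.2 := by
  have inj : ∀ x ∈ distinctQuadruples α,
      Function.Injective ![x.1, x.2.1, x.2.2.1, x.2.2.2] := by
    rintro ⟨a, b, d, e⟩ hx i j
    simp only [distinctQuadruples, mem_filter, mem_univ, true_and] at hx
    obtain ⟨h1, h2, h3, h4, h5, h6⟩ := hx
    fin_cases i <;> fin_cases j <;>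
      simp [h1, h2, h3, h4, h5, h6, h1.symm, h2.symm, h3.symm, h4.symm, h5.symm, h6.symm]
  obtain ⟨S, h1, h2⟩ := exists_sum_smul_eq (G := Equiv.Perm α) (distinctQuadruples α)
    (by simp [distinctQuadruples]) (by
      intro x hx y hy
      obtain ⟨σ, hσ⟩ := exists_perm_comp_eq _ _ (inj x hx) (inj y hy)
      exact ⟨σ, Prod.ext (hσ 0) (Prod.ext (hσ 1) (Prod.ext (hσ 2) (hσ 3)))⟩)
    (fun x => F x.1 x.2.1 x.2.2.1 x.2.2.2)
  refine ⟨S, fun a b d e _ _ _ _ _ _ => h1 (a, b, d, e) (by simp [distinctQuadruples, *]), ?_⟩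
  rw [h2, Fintype.card_perm]

end

theorem sum_consecutive (n : ℕ) (hn : 1 ≤ n) :
    ∑ i : Fin n, ∑ j : Fin n, (if i.val + 1 = j.val then (1 : ℝ) else 0) = n - 1 := by
  obtain ⟨m, rfl⟩ := Nat.exists_eq_add_of_le' hn
  rw [sum_comm, Fin.sum_univ_succ]
  have h : ∀ (i : Fin (m + 1)) (j : Fin m), (i.val + 1 = j.succ.val) = (i = j.castSucc) := by
    intro i j
    simp [Fin.ext_iff]
  simp only [h]
  simp

/-- Variance of the number `T` of adjacent agreements in a uniformly random arrangement of a
multiset with colour counts `r_j` (realised as `c ∘ σ` for `σ` a uniformly random permutation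
of the `h = n + 1 ≥ 2` positions):
`Var T = m₂²/(h²(h-1)) + (h-3) m₂/(h(h-1)) - 2 m₃/(h(h-1))`. -/
theorem variance_adjacent_agreements (k n : ℕ) (hk : 1 ≤ k) (hn : 1 ≤ n)
    (c : Fin (n + 1) → Fin k)
    (T : Equiv.Perm (Fin (n + 1)) → ℝ)
    (hT : T = fun σ => ∑ i : Fin n, (if c (σ i.succ) = c (σ i.castSucc) then (1:ℝ) else 0))
    (h m₂ m₃ : ℝ)
    (hh : h = (n : ℝ) + 1)
    (hm₂ : m₂ = ∑ j : Fin k, (((univ.filter fun i => c i = j).card : ℝ) *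
        (((univ.filter fun i => c i = j).card : ℝ) - 1)))
    (hm₃ : m₃ = ∑ j : Fin k, (((univ.filter fun i => c i = j).card : ℝ) *
        (((univ.filter fun i => c i = j).card : ℝ) - 1) *
        (((univ.filter fun i => c i = j).card : ℝ) - 2))) :
    (∑ σ : Equiv.Perm (Fin (n + 1)), (T σ) ^ 2) / (Nat.factorial (n + 1))
      - ((∑ σ : Equiv.Perm (Fin (n + 1)), T σ) / (Nat.factorial (n + 1))) ^ 2
    = m₂ ^ 2 / (h ^ 2 * (h - 1)) + (h - 3) * m₂ / (h * (h - 1)) - 2 * m₃ / (h * (h - 1)) := by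
  have hT' : ∀ σ, T σ = ∑ i : Fin n, agree c (σ i.succ) (σ i.castSucc) := by
    intro σ
    rw [hT]
    refine sum_congr rfl fun i _ => ?_
    have : i.succ ≠ i.castSucc := i.castSucc_lt_succ.ne'
    simp [agree, this]
  obtain ⟨S₂, hS₂, e₂⟩ := exists_sum_perm_pair (agree c)
  obtain ⟨S₃, hS₃, e₃⟩ := exists_sum_perm_triple (fun a b d => agree c a b * agree c a d)
  obtain ⟨S₄, hS₄, e₄⟩ := exists_sum_perm_quadruple (fun a b d e => agree c a b * agree c d e)
  have hm₂' : ∑ a, (colourCount c (c a) - 1) = m₂ := by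
    rw [hm₂, sum_comp_colour c fun j => colourCount c j - 1]
    rfl
  have hm₃' : ∑ a, (colourCount c (c a) - 1) * (colourCount c (c a) - 2) = m₃ := by
    rw [hm₃, sum_comp_colour c fun j => (colourCount c j - 1) * (colourCount c j - 2)]
    simp only [← mul_assoc]
    rfl
  rw [sum_distinctPairs_agree, card_distinctPairs, hm₂'] at e₂
  rw [sum_distinctTriples_agree, card_distinctTriples, hm₃'] at e₃
  rw [sum_distinctQuadruples_agree, card_distinctQuadruples, hm₂', hm₃'] at e₄
  simp only [Fintype.card_fin, Nat.cast_add, Nat.cast_one] at e₂ e₃ e₄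
  have first : ∑ σ, T σ = n * S₂ := by
    simp only [hT']
    rw [sum_comm, sum_congr rfl fun i _ => hS₂ _ _ i.castSucc_lt_succ.ne']
    simp
  have cov : ∀ i j : Fin n, ∑ σ : Equiv.Perm (Fin (n + 1)),
      agree c (σ i.succ) (σ i.castSucc) * agree c (σ j.succ) (σ j.castSucc) =
      S₄ + (S₂ - S₄) * (if i = j then 1 else 0)
        + (S₃ - S₄) * (if i.val + 1 = j.val then 1 else 0)
        + (S₃ - S₄) * (if j.val + 1 = i.val then 1 else 0) := by
    intro i j
    by_cases h1 : i = j
    · subst h1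
      simp only [agree_mul_self]
      rw [hS₂ _ _ i.castSucc_lt_succ.ne']
      simp
    by_cases h2 : i.val + 1 = j.val
    · have hij : j.castSucc = i.succ := Fin.ext (by simp [h2])
      have h3 : ¬ j.val + 1 = i.val := by omega
      rw [hij, sum_congr rfl fun σ _ => by rw [agree_comm c (σ j.succ)],
        hS₃ _ _ _ (by simp [Fin.ext_iff]) (by simp [Fin.ext_iff]; omega)
          (by simp [Fin.ext_iff]; omega)]
      simp [h1, h2, h3]
    by_cases h3 : j.val + 1 = i.val
    · have hij : i.castSucc = j.succ := Fin.ext (by simp [h3])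
      rw [hij, sum_congr rfl fun σ _ => by rw [agree_comm c (σ i.succ)],
        hS₃ _ _ _ (by simp [Fin.ext_iff]; omega) (by simp [Fin.ext_iff])
          (by simp [Fin.ext_iff]; omega)]
      simp [h1, h2, h3]
    · rw [hS₄] <;> first | (simp [h1, h2, h3]; done) | (simp [Fin.ext_iff] at * <;> omega)
  have second : ∑ σ, T σ ^ 2 =
      n * n * S₄ + (S₂ - S₄) * n + 2 * (S₃ - S₄) * (n - 1) := by
    simp only [hT', sq, sum_mul_sum]
    rw [sum_comm, sum_congr rfl fun i _ => sum_comm]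
    have h4 := sum_consecutive n hn
    have h5 := h4
    rw [sum_comm] at h5
    simp only [cov, sum_add_distrib, ← mul_sum, h4, h5]
    simp
    ring
  have hn0 : (n : ℝ) ≠ 0 := by positivity
  have hn1 : (n : ℝ) + 1 ≠ 0 := by positivity
  have hf : ((n + 1).factorial : ℝ) ≠ 0 := by positivity
  rw [first, second, hh]
  generalize ((n + 1).factorial : ℝ) = N at *
  have q₂ : S₂ = N * m₂ / ((n + 1) * n) := by
    rw [eq_div_iff (by positivity)]
    linear_combination e₂
  have q₃ : (n - 1) * S₃ = N * m₃ / ((n + 1) * n) := by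
    rw [eq_div_iff (by positivity)]
    linear_combination e₃
  have q₄ : (n - 1) * (n - 2) * S₄ = N * (m₂ ^ 2 - 4 * m₃ - 2 * m₂) / ((n + 1) * n) := by
    rw [eq_div_iff (by positivity)]
    linear_combination e₄
  have hsum : (n * n * S₄ + (S₂ - S₄) * n + 2 * (S₃ - S₄) * (n - 1) : ℝ) =
      N * m₂ / (n + 1) + 2 * (N * m₃ / ((n + 1) * n))
        + N * (m₂ ^ 2 - 4 * m₃ - 2 * m₂) / ((n + 1) * n) := by
    rw [← q₃, ← q₄, q₂]
    field_simp
    ring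
  rw [hsum, q₂, add_sub_cancel_right]
  field_simp
  ring
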